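/- For every n ≥ 1, the polynomials T_n^E(x) and T_n^O(x) satisfy the recurrence system T_{n+1}^E(x) = nx·T_n^E(x) + 2x(1−x)·(T_n^E)′(x) + x·T_n^O(x) and T_{n+1}^O(x) = ((n−1)x+1)·T_n^O(x) + 2x(1−x)·(T_n^O)′(x) + T_n^E(x), with initial conditions T_1^E(x) = 0 and T_1^O(x) = 1. -/

import Mathlib

open Polynomial Finset

/-- The value `π(i)` of a permutation of `[n]` at position `i ∈ [n]`
(1-indexed), with the convention `π(0) = 0`. -/
def pval (n : ℕ) (π : Equiv.Perm (Fin n)) (i : ℕ) : ℤ :=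
  if h : 1 ≤ i ∧ i ≤ n then ((π ⟨i - 1, by omega⟩ : Fin n).val + 1 : ℤ) else 0

/-- The interior peak number
`ipk(π) = #{i ∈ [2, n-1] : π(i-1) < π(i) > π(i+1)}`. -/
def ipk (n : ℕ) (π : Equiv.Perm (Fin n)) : ℕ :=
  ((Finset.Icc 2 (n - 1)).filter
    (fun i => pval n π (i - 1) < pval n π i ∧ pval n π (i + 1) < pval n π i)).card

/-- The left peak number
`lpk(π) = #{i ∈ [n-1] : π(i-1) < π(i) > π(i+1)}` with `π(0) = 0`. -/
def lpk (n : ℕ) (π : Equiv.Perm (Fin n)) : ℕ :=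
  ((Finset.Icc 1 (n - 1)).filter
    (fun i => pval n π (i - 1) < pval n π i ∧ pval n π (i + 1) < pval n π i)).card

/-- The interior peak polynomial `W_n(x) = Σ_{π ∈ S_n} x^{ipk(π)}`. -/
noncomputable def Wpoly (n : ℕ) : Polynomial ℝ :=
  ∑ π : Equiv.Perm (Fin n), X ^ ipk n π

/-- The left peak polynomial `W̄_n(x) = Σ_{π ∈ S_n} x^{lpk(π)}`. -/
noncomputable def Wbarpoly (n : ℕ) : Polynomial ℝ :=
  ∑ π : Equiv.Perm (Fin n), X ^ lpk n π

/-- The number of up-down runs of `π`, i.e. the number of maximal monotone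
consecutive blocks of the sequence `0, π(1), …, π(n)`.  Since consecutive
entries of this sequence are distinct, for `n ≥ 1` this number equals one plus
the number of interior direction changes (peaks or valleys) of the sequence. -/
def udrun (n : ℕ) (π : Equiv.Perm (Fin n)) : ℕ :=
  if n = 0 then 0
  else
    1 + ((Finset.Icc 1 (n - 1)).filter
      (fun i =>
        (pval n π (i - 1) < pval n π i ∧ pval n π (i + 1) < pval n π i) ∨
        (pval n π i < pval n π (i - 1) ∧ pval n π i < pval n π (i + 1)))).card

/-- The up-down run polynomial `T_n(x) = Σ_{π ∈ S_n} x^{udrun(π)}`. -/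
noncomputable def Tpoly (n : ℕ) : Polynomial ℝ :=
  ∑ π : Equiv.Perm (Fin n), X ^ udrun n π

/-- `T_n^E(x) = Σ_{π ∈ S_n, π(n-1) > π(n)} x^{lpk(π)}` (with `π(0) = 0`). -/
noncomputable def TEpoly (n : ℕ) : Polynomial ℝ :=
  ∑ π ∈ Finset.univ.filter
      (fun π : Equiv.Perm (Fin n) => pval n π n < pval n π (n - 1)),
    X ^ lpk n π

/-- `T_n^O(x) = Σ_{π ∈ S_n, π(n-1) < π(n)} x^{lpk(π)}` (with `π(0) = 0`). -/
noncomputable def TOpoly (n : ℕ) : Polynomial ℝ :=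
  ∑ π ∈ Finset.univ.filter
      (fun π : Equiv.Perm (Fin n) => pval n π (n - 1) < pval n π n),
    X ^ lpk n π

/-- The left peak set of the first `n` letters of a word `a 1, a 2, …` preceded by `a 0`. -/
def leftPeaks (n : ℕ) (a : ℕ → ℤ) : Finset ℕ :=
  (Finset.Icc 1 (n - 1)).filter (fun i => a (i - 1) < a i ∧ a (i + 1) < a i)

/-- The word obtained from `a` by inserting the letter `M` right after position `p`. -/
def insertLetter (a : ℕ → ℤ) (M : ℤ) (p i : ℕ) : ℤ :=
  if i ≤ p then a i else if i = p + 1 then M else a (i - 1)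

lemma mem_leftPeaks {n : ℕ} {a : ℕ → ℤ} {i : ℕ} :
    i ∈ leftPeaks n a ↔ (1 ≤ i ∧ i ≤ n - 1) ∧ a (i - 1) < a i ∧ a (i + 1) < a i := by
  simp [leftPeaks]

lemma succ_notMem_leftPeaks {n : ℕ} {a : ℕ → ℤ} {i : ℕ} (hi : i ∈ leftPeaks n a) :
    i + 1 ∉ leftPeaks n a := by
  intro h
  rw [mem_leftPeaks] at hi h
  have h₁ := h.2.1
  rw [Nat.add_sub_cancel] at h₁
  exact lt_asymm h₁ hi.2.2

lemma leftPeaks_insertLetter_last {n : ℕ} {a : ℕ → ℤ} {M : ℤ} (hM : ∀ i, a i < M) :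
    leftPeaks (n + 1) (insertLetter a M n) = leftPeaks n a := by
  ext i
  have := hM i
  simp only [mem_leftPeaks, insertLetter]
  grind

lemma leftPeaks_insertLetter {n p : ℕ} {a : ℕ → ℤ} {M : ℤ} (hM : ∀ i, a i < M) (hp : p < n) :
    leftPeaks (n + 1) (insertLetter a M p) =
      insert (p + 1)
        ((leftPeaks n a \ {p, p + 1}).image (fun i => if i ≤ p then i else i + 1)) := by
  ext i
  simp only [Finset.mem_insert, Finset.mem_image, Finset.mem_sdiff, Finset.mem_singleton]
  rcases lt_trichotomy i (p + 1) with h | rfl | h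
  · trans i ∈ leftPeaks n a ∧ ¬ (i = p ∨ i = p + 1)
    · have := hM i
      simp only [mem_leftPeaks, insertLetter]
      grind
    · grind
  · have h₁ := hM p
    have h₂ := hM (p + 1)
    simp only [mem_leftPeaks, insertLetter]
    grind
  · obtain ⟨j, rfl⟩ : ∃ j, i = j + 1 := ⟨i - 1, by omega⟩
    trans j ∈ leftPeaks n a ∧ ¬ (j = p ∨ j = p + 1)
    · have := hM j
      simp only [mem_leftPeaks, insertLetter]
      grind
    · grind

lemma card_leftPeaks_insertLetter {n p : ℕ} {a : ℕ → ℤ} {M : ℤ} (hM : ∀ i, a i < M)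
    (hp : p < n) :
    (leftPeaks (n + 1) (insertLetter a M p)).card =
      if p ∈ leftPeaks n a ∨ p + 1 ∈ leftPeaks n a then (leftPeaks n a).card
      else (leftPeaks n a).card + 1 := by
  rw [leftPeaks_insertLetter hM hp, Finset.card_insert_of_notMem (by grind),
    Finset.card_image_of_injective _ (fun i j h => by grind)]
  by_cases h₁ : p ∈ leftPeaks n a
  · have h₂ := succ_notMem_leftPeaks h₁
    have : leftPeaks n a \ {p, p + 1} = (leftPeaks n a).erase p := by grind
    rw [this, if_pos (Or.inl h₁), Finset.card_erase_add_one h₁]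
  · by_cases h₂ : p + 1 ∈ leftPeaks n a
    · have : leftPeaks n a \ {p, p + 1} = (leftPeaks n a).erase (p + 1) := by grind
      rw [this, if_pos (Or.inr h₂), Finset.card_erase_add_one h₂]
    · have : leftPeaks n a \ {p, p + 1} = leftPeaks n a := by grind
      rw [this, if_neg (by tauto)]

lemma card_filter_adjacent {P : Finset ℕ} {m : ℕ} (hP : P ⊆ Finset.Icc 1 (m - 1))
    (hsucc : ∀ i ∈ P, i + 1 ∉ P) :
    ((Finset.range m).filter (fun p => p ∈ P ∨ p + 1 ∈ P)).card = 2 * P.card := by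
  have hbound : ∀ i ∈ P, 1 ≤ i ∧ i ≤ m - 1 := fun i hi => Finset.mem_Icc.1 (hP hi)
  have h : (Finset.range m).filter (fun p => p ∈ P ∨ p + 1 ∈ P) =
      P ∪ P.image (fun i => i - 1) := by
    ext p
    simp only [Finset.mem_filter, Finset.mem_range, Finset.mem_union, Finset.mem_image]
    constructor
    · rintro ⟨-, h | h⟩
      · exact Or.inl h
      · exact Or.inr ⟨p + 1, h, rfl⟩
    · rintro (h | ⟨i, hi, rfl⟩)
      · have := hbound p h
        exact ⟨by omega, Or.inl h⟩
      · have := hbound i hi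
        refine ⟨by omega, Or.inr ?_⟩
        rwa [Nat.sub_add_cancel this.1]
  rw [h, Finset.card_union_of_disjoint, Finset.card_image_of_injOn, two_mul]
  · intro i hi j hj hij
    have := hbound i hi
    have := hbound j hj
    simp only at hij
    omega
  · rw [Finset.disjoint_left]
    intro p hp h
    obtain ⟨i, hi, rfl⟩ := Finset.mem_image.1 h
    have := hsucc _ hp
    rw [Nat.sub_add_cancel (hbound i hi).1] at this
    exact this hi

lemma sum_pow_adjacent {P : Finset ℕ} {m : ℕ} (hP : P ⊆ Finset.Icc 1 (m - 1))
    (hsucc : ∀ i ∈ P, i + 1 ∉ P) :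
    (∑ p ∈ Finset.range m, (X : ℝ[X]) ^ (if p ∈ P ∨ p + 1 ∈ P then P.card else P.card + 1)) =
      C (m : ℝ) * X * X ^ P.card + 2 * X * (1 - X) * derivative (X ^ P.card) := by
  have hcard := card_filter_adjacent hP hsucc
  have hsum := Finset.card_filter_add_card_filter_not (s := Finset.range m)
    (fun p => p ∈ P ∨ p + 1 ∈ P)
  rw [hcard, Finset.card_range] at hsum
  have hm : (m : ℝ[X]) = 2 * (P.card : ℝ[X]) +
      (((Finset.range m).filter (fun p => ¬ (p ∈ P ∨ p + 1 ∈ P))).card : ℝ[X]) := by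
    exact_mod_cast hsum.symm
  have hder : (X : ℝ[X]) * derivative (X ^ P.card) = (P.card : ℝ[X]) * X ^ P.card := by
    rcases P.card with _ | k
    · simp
    · rw [derivative_X_pow_succ]
      simp only [map_add, map_natCast, map_one]
      push_cast
      ring
  simp only [apply_ite (fun k => (X : ℝ[X]) ^ k)]
  rw [Finset.sum_ite, Finset.sum_const, Finset.sum_const, hcard, nsmul_eq_mul, nsmul_eq_mul,
    map_natCast, hm]
  push_cast
  linear_combination (-2 * (1 - X)) * hder

lemma pval_lt (n : ℕ) (σ : Equiv.Perm (Fin n)) (i : ℕ) : pval n σ i < n + 1 := by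
  unfold pval
  split_ifs with h
  · have := (σ ⟨i - 1, by omega⟩).isLt
    omega
  · omega

lemma pval_pred_ne {n : ℕ} (hn : 1 ≤ n) (σ : Equiv.Perm (Fin n)) :
    pval n σ (n - 1) ≠ pval n σ n := by
  unfold pval
  rw [dif_pos (show 1 ≤ n ∧ n ≤ n by omega)]
  split_ifs with h
  · intro heq
    have := σ.injective (Fin.ext (by omega : (σ ⟨n - 1 - 1, _⟩).val =
      (σ ⟨n - 1, _⟩).val))
    simp only [Fin.mk.injEq] at this
    omega
  · omega

/-- Insert the largest letter into the permutation `σ` at (0-indexed) position `p`. -/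
def insertMax {n : ℕ} (σ : Equiv.Perm (Fin n)) (p : Fin (n + 1)) : Equiv.Perm (Fin (n + 1)) :=
  (finSuccEquiv' p).trans ((Equiv.optionCongr σ).trans (finSuccEquiv' (Fin.last n)).symm)

lemma insertMax_self {n : ℕ} (σ : Equiv.Perm (Fin n)) (p : Fin (n + 1)) :
    insertMax σ p p = Fin.last n := by
  simp [insertMax]

lemma insertMax_succAbove {n : ℕ} (σ : Equiv.Perm (Fin n)) (p : Fin (n + 1)) (j : Fin n) :
    insertMax σ p (p.succAbove j) = (σ j).castSucc := by
  simp [insertMax]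

lemma insertMax_bijective (n : ℕ) :
    Function.Bijective
      (fun q : Equiv.Perm (Fin n) × Fin (n + 1) => insertMax q.1 q.2) := by
  rw [Fintype.bijective_iff_injective_and_card]
  constructor
  · rintro ⟨σ, p⟩ ⟨τ, q⟩ h
    simp only at h
    have hpq : p = q := by
      apply (insertMax τ q).injective
      rw [insertMax_self, ← h, insertMax_self]
    subst hpq
    refine Prod.ext (Equiv.ext fun j => Fin.castSucc_injective n ?_) rfl
    rw [← insertMax_succAbove σ p j, h, insertMax_succAbove]
  · simp [Fintype.card_perm, Nat.factorial_succ, mul_comm]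

lemma pval_insertMax {n : ℕ} (σ : Equiv.Perm (Fin n)) (p : Fin (n + 1)) :
    pval (n + 1) (insertMax σ p) = insertLetter (pval n σ) (n + 1) p := by
  have hp := p.isLt
  funext i
  unfold insertLetter
  rcases lt_trichotomy i (p + 1) with h | rfl | h
  · rw [if_pos (by omega)]
    unfold pval
    by_cases hi : 1 ≤ i
    · rw [dif_pos (by omega), dif_pos (by omega)]
      have : (⟨i - 1, by omega⟩ : Fin (n + 1)) = p.succAbove ⟨i - 1, by omega⟩ := by
        rw [Fin.succAbove_of_castSucc_lt _ _ (by simp [Fin.lt_def]; omega)]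
        rfl
      rw [this, insertMax_succAbove]
      rfl
    · rw [dif_neg (by omega), dif_neg (by omega)]
  · rw [if_neg (by omega), if_pos rfl]
    unfold pval
    rw [dif_pos (by omega)]
    have : (⟨p.val + 1 - 1, by omega⟩ : Fin (n + 1)) = p := Fin.ext (by simp)
    rw [this, insertMax_self]
    simp
  · rw [if_neg (by omega), if_neg (by omega)]
    unfold pval
    by_cases hi : i ≤ n + 1
    · rw [dif_pos (by omega), dif_pos (by omega)]
      have : (⟨i - 1, by omega⟩ : Fin (n + 1)) = p.succAbove ⟨i - 1 - 1, by omega⟩ := by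
        rw [Fin.succAbove_of_le_castSucc _ _ (by simp [Fin.le_def]; omega)]
        apply Fin.ext
        simp
        omega
      rw [this, insertMax_succAbove]
      rfl
    · rw [dif_neg (by omega), dif_neg (by omega)]

lemma sum_perm_succ {n : ℕ} (r : ℤ → ℤ → Prop) [DecidableRel r] :
    (∑ π ∈ Finset.univ.filter (fun π : Equiv.Perm (Fin (n + 1)) =>
        r (pval (n + 1) π n) (pval (n + 1) π (n + 1))), (X : ℝ[X]) ^ lpk (n + 1) π) =
      ∑ σ : Equiv.Perm (Fin n), ∑ p ∈ Finset.range (n + 1),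
        if r (insertLetter (pval n σ) (n + 1) p n) (insertLetter (pval n σ) (n + 1) p (n + 1))
        then (X : ℝ[X]) ^ (leftPeaks (n + 1) (insertLetter (pval n σ) (n + 1) p)).card
        else 0 := by
  rw [Finset.sum_filter, ← (insertMax_bijective n).sum_comp, Fintype.sum_prod_type]
  refine Finset.sum_congr rfl fun σ _ => ?_
  rw [Finset.sum_range]
  refine Finset.sum_congr rfl fun p _ => ?_
  simp only [← pval_insertMax]
  rfl

lemma sum_insert_descent {n : ℕ} (hn : 1 ≤ n) (σ : Equiv.Perm (Fin n)) :
    (∑ p ∈ Finset.range (n + 1),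
      if insertLetter (pval n σ) (n + 1) p (n + 1) < insertLetter (pval n σ) (n + 1) p n
      then (X : ℝ[X]) ^ (leftPeaks (n + 1) (insertLetter (pval n σ) (n + 1) p)).card
      else 0) =
      if pval n σ n < pval n σ (n - 1)
      then C (n : ℝ) * X * X ^ lpk n σ + 2 * X * (1 - X) * derivative (X ^ lpk n σ)
      else X * X ^ lpk n σ := by
  have hM := pval_lt n σ
  have hMn := hM n
  rw [Finset.sum_range_succ, if_neg (by simp [insertLetter]; omega), add_zero]
  split_ifs with h
  · change _ = C (n : ℝ) * X * X ^ (leftPeaks n (pval n σ)).card +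
      2 * X * (1 - X) * derivative (X ^ (leftPeaks n (pval n σ)).card)
    have hP : leftPeaks n (pval n σ) ⊆ Finset.Icc 1 (n - 1) := Finset.filter_subset _ _
    rw [← sum_pow_adjacent hP (fun _ => succ_notMem_leftPeaks)]
    refine Finset.sum_congr rfl fun p hp => ?_
    rw [Finset.mem_range] at hp
    rw [if_pos (by unfold insertLetter; grind), card_leftPeaks_insertLetter hM hp]
  · obtain ⟨m, rfl⟩ : ∃ m, n = m + 1 := ⟨n - 1, by omega⟩
    rw [Finset.sum_range_succ, Finset.sum_eq_zero, zero_add,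
      if_pos (by unfold insertLetter; grind), card_leftPeaks_insertLetter hM (by omega),
      if_neg, pow_succ']
    · rfl
    · simp only [mem_leftPeaks]
      grind
    · intro p hp
      rw [Finset.mem_range] at hp
      rw [if_neg (by unfold insertLetter; grind)]

lemma sum_insert_ascent {n : ℕ} (hn : 1 ≤ n) (σ : Equiv.Perm (Fin n)) :
    (∑ p ∈ Finset.range (n + 1),
      if insertLetter (pval n σ) (n + 1) p n < insertLetter (pval n σ) (n + 1) p (n + 1)
      then (X : ℝ[X]) ^ (leftPeaks (n + 1) (insertLetter (pval n σ) (n + 1) p)).card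
      else 0) =
      if pval n σ (n - 1) < pval n σ n
      then (C ((n : ℝ) - 1) * X + 1) * X ^ lpk n σ +
        2 * X * (1 - X) * derivative (X ^ lpk n σ)
      else X ^ lpk n σ := by
  have hM := pval_lt n σ
  have hMn := hM n
  obtain ⟨m, rfl⟩ : ∃ m, n = m + 1 := ⟨n - 1, by omega⟩
  rw [Finset.sum_range_succ, if_pos (by simp [insertLetter]; omega),
    leftPeaks_insertLetter_last hM, Finset.sum_range_succ,
    if_neg (by unfold insertLetter; grind), add_zero]
  change _ + X ^ lpk (m + 1) σ = _
  split_ifs with h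
  · have hP : leftPeaks (m + 1) (pval (m + 1) σ) ⊆ Finset.Icc 1 (m - 1) := by
      intro i
      rw [mem_leftPeaks, Finset.mem_Icc]
      grind
    have hsum := sum_pow_adjacent hP (fun _ => succ_notMem_leftPeaks)
    have hcast : ((m + 1 : ℕ) : ℝ) - 1 = m := by push_cast; ring
    rw [hcast]
    trans (C (m : ℝ) * X * X ^ lpk (m + 1) σ +
      2 * X * (1 - X) * derivative (X ^ lpk (m + 1) σ)) + X ^ lpk (m + 1) σ
    · congr 1
      refine Eq.trans (Finset.sum_congr rfl fun p hp => ?_) hsum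
      rw [Finset.mem_range] at hp
      rw [if_pos (by unfold insertLetter; grind), card_leftPeaks_insertLetter hM (by omega)]
    · ring
  · rw [Finset.sum_eq_zero, zero_add]
    intro p hp
    rw [Finset.mem_range] at hp
    rw [if_neg (by unfold insertLetter; grind)]

lemma TEpoly_succ {n : ℕ} (hn : 1 ≤ n) :
    TEpoly (n + 1) =
      C (n : ℝ) * X * TEpoly n + 2 * X * (1 - X) * derivative (TEpoly n) + X * TOpoly n := by
  have hfilter : Finset.univ.filter
      (fun π : Equiv.Perm (Fin n) => pval n π (n - 1) < pval n π n) =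
      Finset.univ.filter (fun π => ¬ pval n π n < pval n π (n - 1)) :=
    Finset.filter_congr fun σ _ => by have := pval_pred_ne hn σ; omega
  refine (sum_perm_succ (fun x y => y < x)).trans ?_
  simp only [sum_insert_descent hn]
  rw [Finset.sum_ite, TEpoly, TOpoly, hfilter, derivative_sum, Finset.sum_add_distrib]
  simp only [Finset.mul_sum]

lemma TOpoly_succ {n : ℕ} (hn : 1 ≤ n) :
    TOpoly (n + 1) =
      (C ((n : ℝ) - 1) * X + 1) * TOpoly n + 2 * X * (1 - X) * derivative (TOpoly n) +
        TEpoly n := by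
  have hfilter : Finset.univ.filter
      (fun π : Equiv.Perm (Fin n) => pval n π n < pval n π (n - 1)) =
      Finset.univ.filter (fun π => ¬ pval n π (n - 1) < pval n π n) :=
    Finset.filter_congr fun σ _ => by have := pval_pred_ne hn σ; omega
  refine (sum_perm_succ (fun x y => x < y)).trans ?_
  simp only [sum_insert_ascent hn]
  rw [Finset.sum_ite, TEpoly, TOpoly, hfilter, derivative_sum, Finset.sum_add_distrib]
  simp only [Finset.mul_sum]

/-- For every `n ≥ 1`, the polynomials `T_n^E` and `T_n^O` satisfy the Eulerian
recurrence system
`T_{n+1}^E = nx·T_n^E + 2x(1-x)(T_n^E)' + x·T_n^O`,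
`T_{n+1}^O = ((n-1)x+1)·T_n^O + 2x(1-x)(T_n^O)' + T_n^E`,
with initial conditions `T_1^E = 0` and `T_1^O = 1`. -/
theorem TE_TO_recurrence_system :
    TEpoly 1 = 0 ∧ TOpoly 1 = 1 ∧
    ∀ n : ℕ, 1 ≤ n →
      TEpoly (n + 1) =
        Polynomial.C (n : ℝ) * X * TEpoly n +
          2 * X * (1 - X) * derivative (TEpoly n) + X * TOpoly n ∧
      TOpoly (n + 1) =
        (Polynomial.C ((n : ℝ) - 1) * X + 1) * TOpoly n +
          2 * X * (1 - X) * derivative (TOpoly n) + TEpoly n := by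
  refine ⟨?_, ?_, fun n hn => ⟨TEpoly_succ hn, TOpoly_succ hn⟩⟩
  · simp [TEpoly, pval]
  · simp [TOpoly, pval, lpk]
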